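/- Let k(t,s) = a₀ + a₁t + c₁s on [M₁,M₂] × [α,β] with α < β, let k₁(t,s) = ∫_α^β k(t,τ)k(τ,s)dτ, and suppose δ₂ ≠ 0, δ₁ ≠ 1, a₁ ≠ 0 and c₁ = 0. Then δ₁k(t,s) + δ₂k₁(t,s) = k(t,s) holds for almost every (t,s) ∈ [M₁,M₂] × [α,β] if and only if a₀ = (2 − 2δ₁ − δ₂(β² − α²)a₁) / (2δ₂(β − α)). -/

import Mathlib

open MeasureTheory

/-- The affine kernel `k(t,s) = a₀ + a₁ t + c₁ s`. -/
def kaff (a₀ a₁ c₁ : ℝ) : ℝ → ℝ → ℝ := fun t s => a₀ + a₁ * t + c₁ * s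

/-- The first iterated kernel `k₁(t,s) = ∫_α^β k(t,τ) k(τ,s) dτ`. -/
noncomputable def k1aff (a₀ a₁ c₁ α β : ℝ) : ℝ → ℝ → ℝ :=
  fun t s => ∫ τ in α..β, kaff a₀ a₁ c₁ t τ * kaff a₀ a₁ c₁ τ s

/-- For `c₁ = 0` the iterated kernel is a constant multiple of the kernel. -/
theorem k1aff_zero (a₀ a₁ α β t s : ℝ) :
    k1aff a₀ a₁ 0 α β t s = (a₀ + a₁ * t) * (a₀ * (β - α) + a₁ * ((β ^ 2 - α ^ 2) / 2)) := by
  have hi : IntervalIntegrable (fun τ : ℝ => a₁ * τ) volume α β :=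
    (by fun_prop : Continuous fun τ : ℝ => a₁ * τ).intervalIntegrable _ _
  simp only [k1aff, kaff, zero_mul, add_zero]
  rw [intervalIntegral.integral_const_mul, intervalIntegral.integral_add (by simp) hi,
    intervalIntegral.integral_const_mul, integral_id, intervalIntegral.integral_const, smul_eq_mul]
  ring

/-- A vertical line is a null set of the plane. -/
theorem ae_fst_ne (c : ℝ) : ∀ᵐ q ∂(volume : Measure (ℝ × ℝ)), q.1 ≠ c := by
  have h : {q : ℝ × ℝ | ¬ q.1 ≠ c} = {c} ×ˢ Set.univ := by
    ext q
    simp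
  rw [ae_iff, h, Measure.volume_eq_prod, Measure.prod_prod]
  simp

/-- Case δ₂ ≠ 0, δ₁ ≠ 1, a₁ ≠ 0, c₁ = 0: `δ₁ k + δ₂ k₁ = k` a.e. on `[M₁,M₂] × [α,β]`
iff `a₀ = (2 - 2δ₁ - δ₂(β² - α²)a₁)/(2δ₂(β - α))`. -/
theorem kernel_fixed_point_case_a1_delta1_ne_one (M₁ M₂ α β : ℝ) (hM : M₁ < M₂) (hαβ : α < β)
    (hsub : Set.Icc α β ⊆ Set.Icc M₁ M₂)
    (a₀ a₁ c₁ δ₁ δ₂ : ℝ) (hδ₂ : δ₂ ≠ 0) (hδ₁ : δ₁ ≠ 1) (ha₁ : a₁ ≠ 0) (hc₁ : c₁ = 0) :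
    (∀ᵐ q ∂((volume : Measure (ℝ × ℝ)).restrict (Set.Icc M₁ M₂ ×ˢ Set.Icc α β)),
        δ₁ * kaff a₀ a₁ c₁ q.1 q.2 + δ₂ * k1aff a₀ a₁ c₁ α β q.1 q.2
          = kaff a₀ a₁ c₁ q.1 q.2) ↔
      a₀ = (2 - 2 * δ₁ - δ₂ * (β ^ 2 - α ^ 2) * a₁) / (2 * δ₂ * (β - α)) := by
  subst hc₁
  have hβα : β - α ≠ 0 := sub_ne_zero.mpr hαβ.ne'
  have key (t s : ℝ) : δ₁ * kaff a₀ a₁ 0 t s + δ₂ * k1aff a₀ a₁ 0 α β t s - kaff a₀ a₁ 0 t s =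
      (a₀ + a₁ * t) *
        (a₀ * (2 * δ₂ * (β - α)) - (2 - 2 * δ₁ - δ₂ * (β ^ 2 - α ^ 2) * a₁)) / 2 := by
    rw [k1aff_zero, kaff]
    ring
  rw [eq_div_iff (mul_ne_zero (mul_ne_zero two_ne_zero hδ₂) hβα)]
  constructor
  · intro h
    by_contra hne
    have hfalse : ∀ᵐ _ ∂((volume : Measure (ℝ × ℝ)).restrict (Set.Icc M₁ M₂ ×ˢ Set.Icc α β)),
        False := by
      filter_upwards [h, ae_restrict_of_ae (ae_fst_ne (-a₀ / a₁))] with q hq hqne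
      have hk := key q.1 q.2
      rw [hq, sub_self, eq_comm, div_eq_zero_iff, mul_eq_zero] at hk
      rcases hk with (hk | hk) | hk
      · exact hqne (by rw [eq_div_iff ha₁]; linarith)
      · exact hne (sub_eq_zero.mp hk)
      · norm_num at hk
    rw [Filter.eventually_false_iff_eq_bot, ae_eq_bot, Measure.restrict_eq_zero,
      Measure.volume_eq_prod, Measure.prod_prod, Real.volume_Icc, Real.volume_Icc,
      mul_eq_zero, ENNReal.ofReal_eq_zero, ENNReal.ofReal_eq_zero] at hfalse
    rcases hfalse with hf | hf <;> linarith
  · intro h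
    refine Filter.Eventually.of_forall fun q => ?_
    have hk := key q.1 q.2
    rwa [h, sub_self, mul_zero, zero_div, sub_eq_zero] at hk
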